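/- arXiv:2201.10793 — 2 statements merged into one kernel-verified Lean document; each statement's English description precedes it below -/
import Mathlib

section
/- Let (e_1,…,e_n) be an orthonormal basis of V and X, Y ∈ V. Then Σ_{j=1}^n tr(c(X)∘c̄(Y)∘c(e_j)∘c(X)∘c̄(Y)∘c(e_j)) = (2−n)·2^n·‖X‖²‖Y‖². -/
open scoped RealInnerProductSpace

noncomputable section

variable {V : Type*} [NormedAddCommGroup V] [InnerProductSpace ℝ V]

/-- Left exterior multiplication `ε(v)` on the exterior algebra `ΛV`. -/
def extMul (v : V) : Module.End ℝ (ExteriorAlgebra ℝ V) :=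
  LinearMap.mulLeft ℝ (ExteriorAlgebra.ι ℝ v)

/-- Interior multiplication (contraction) `ι(v)` on the exterior algebra `ΛV`:
the unique antiderivation with `ι(v) w = ⟪v, w⟫` for `w ∈ V`. -/
def intMul (v : V) : Module.End ℝ (ExteriorAlgebra ℝ V) :=
  CliffordAlgebra.contractLeft (Q := (0 : QuadraticForm ℝ V)) (innerₛₗ ℝ v)

/-- The Clifford action `c(v) = ε(v) - ι(v)`. -/
def cl (v : V) : Module.End ℝ (ExteriorAlgebra ℝ V) := extMul v - intMul v

/-- The Clifford action `c̄(v) = ε(v) + ι(v)`. -/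
def clBar (v : V) : Module.End ℝ (ExteriorAlgebra ℝ V) := extMul v + intMul v

/-- Trace of an endomorphism of `ΛV`. -/
abbrev trΛ : Module.End ℝ (ExteriorAlgebra ℝ V) →ₗ[ℝ] ℝ :=
  LinearMap.trace ℝ (ExteriorAlgebra ℝ V)

lemma extMul_mul_extMul (u v : V) :
    extMul u * extMul v = -(extMul v * extMul u) := by
  refine LinearMap.ext fun x => ?_
  have h := ExteriorAlgebra.ι_add_mul_swap (R := ℝ) u v
  simp only [extMul, Module.End.mul_apply, LinearMap.neg_apply, LinearMap.mulLeft_apply,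
    ← mul_assoc]
  rw [eq_neg_of_add_eq_zero_left h, neg_mul]

lemma intMul_mul_intMul (u v : V) :
    intMul u * intMul v = -(intMul v * intMul u) := by
  refine LinearMap.ext fun x => ?_
  exact CliffordAlgebra.contractLeft_comm (Q := (0 : QuadraticForm ℝ V)) _ _ _

lemma intMul_mul_extMul (u v : V) :
    intMul u * extMul v = ⟪u, v⟫ • 1 - extMul v * intMul u := by
  refine LinearMap.ext fun x => ?_
  exact CliffordAlgebra.contractLeft_ι_mul (Q := (0 : QuadraticForm ℝ V)) (innerₛₗ ℝ u) v x

lemma cl_mul_cl (u v : V) : cl u * cl v = -(2 * ⟪u, v⟫) • 1 - cl v * cl u := by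
  simp only [cl, sub_mul, mul_sub]
  rw [extMul_mul_extMul u v, intMul_mul_intMul u v, intMul_mul_extMul u v,
    intMul_mul_extMul v u, real_inner_comm u v]
  module

lemma clBar_mul_clBar (u v : V) :
    clBar u * clBar v = (2 * ⟪u, v⟫) • 1 - clBar v * clBar u := by
  simp only [clBar, add_mul, mul_add]
  rw [extMul_mul_extMul u v, intMul_mul_intMul u v, intMul_mul_extMul u v,
    intMul_mul_extMul v u, real_inner_comm u v]
  module

lemma cl_mul_clBar (u v : V) : cl u * clBar v = -(clBar v * cl u) := by
  simp only [cl, clBar, sub_mul, mul_sub, add_mul, mul_add]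
  rw [extMul_mul_extMul u v, intMul_mul_intMul u v, intMul_mul_extMul u v,
    intMul_mul_extMul v u, real_inner_comm u v]
  module

lemma cl_mul_self (v : V) : cl v * cl v = -(‖v‖ ^ 2) • 1 := by
  have h := cl_mul_cl v v
  rw [real_inner_self_eq_norm_sq] at h
  rw [eq_sub_iff_add_eq, ← two_smul ℝ] at h
  refine smul_right_injective _ (two_ne_zero' ℝ) ?_
  simp only [h]
  module

lemma clBar_mul_self (v : V) : clBar v * clBar v = (‖v‖ ^ 2) • 1 := by
  have h := clBar_mul_clBar v v
  rw [real_inner_self_eq_norm_sq] at h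
  rw [eq_sub_iff_add_eq, ← two_smul ℝ] at h
  refine smul_right_injective _ (two_ne_zero' ℝ) ?_
  simp only [h]
  module

/-- The Clifford action `c`, as a linear map. -/
def clLinear : V →ₗ[ℝ] Module.End ℝ (ExteriorAlgebra ℝ V) where
  toFun := cl
  map_add' u v := by
    refine LinearMap.ext fun x => ?_
    simp only [cl, extMul, intMul, map_add, LinearMap.sub_apply, LinearMap.add_apply,
      LinearMap.mulLeft_apply, add_mul]
    abel
  map_smul' r v := by
    refine LinearMap.ext fun x => ?_
    simp [cl, extMul, intMul, smul_sub]

lemma sum_inner_smul_cl {ι : Type*} [Fintype ι] (e : OrthonormalBasis ι ℝ V) (v : V) :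
    ∑ j, ⟪v, e j⟫ • cl (e j) = cl v := by
  have h := congrArg clLinear (e.sum_repr' v)
  simpa only [map_sum, map_smul, clLinear, LinearMap.coe_mk, AddHom.coe_mk,
    real_inner_comm] using h

lemma mul_mul_mul_mul_of_anticommute {R : Type*} [Ring R] {a b c : R}
    (hab : a * b = -(b * a)) (hcb : c * b = -(b * c)) :
    b * (c * (a * (b * c))) = b * b * (c * (a * c)) := by
  rw [← mul_assoc a, hab, neg_mul, mul_neg, mul_assoc b a, ← mul_assoc c b, hcb]
  noncomm_ring

lemma cl_clBar_cl_mul_self (X Y v : V) (hv : ‖v‖ = 1) :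
    cl X * (clBar Y * (cl v * (cl X * (clBar Y * cl v)))) =
      ‖Y‖ ^ 2 • (-(2 : ℝ) • (cl X * (⟪X, v⟫ • cl v)) - ‖X‖ ^ 2 • 1) := by
  have hB : clBar Y * (cl v * (cl X * (clBar Y * cl v))) =
      ‖Y‖ ^ 2 • (cl v * (cl X * cl v)) := by
    rw [mul_mul_mul_mul_of_anticommute (cl_mul_clBar X Y) (cl_mul_clBar v Y),
      clBar_mul_self, smul_mul_assoc, one_mul]
  have hE : cl v * (cl X * cl v) = -(2 * ⟪X, v⟫) • cl v + cl X := by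
    rw [cl_mul_cl X v, mul_sub, ← mul_assoc (cl v), cl_mul_self, hv,
      mul_smul_comm, mul_one, smul_mul_assoc, one_mul]
    module
  rw [hB, hE, mul_smul_comm, mul_add, cl_mul_self, mul_smul_comm, mul_smul_comm]
  module

lemma finrank_exteriorAlgebra {n : ℕ} (e : OrthonormalBasis (Fin n) ℝ V) :
    Module.finrank ℝ (ExteriorAlgebra ℝ V) = 2 ^ n := by
  rw [Module.finrank_eq_card_basis e.toBasis.ExteriorAlgebra]
  simp

theorem trace_sum_ccbar_XYj [FiniteDimensional ℝ V] (n : ℕ)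
    (e : OrthonormalBasis (Fin n) ℝ V) (X Y : V) :
    ∑ j : Fin n,
        trΛ (cl X ∘ₗ clBar Y ∘ₗ cl (e j) ∘ₗ cl X ∘ₗ clBar Y ∘ₗ cl (e j))
      = ((2 : ℝ) - n) * 2 ^ n * ‖X‖ ^ 2 * ‖Y‖ ^ 2 := by
  have hsum : ∑ j : Fin n, cl X * (clBar Y * (cl (e j) * (cl X * (clBar Y * cl (e j))))) =
      (((2 : ℝ) - n) * ‖X‖ ^ 2 * ‖Y‖ ^ 2) • 1 := by
    simp only [cl_clBar_cl_mul_self X Y _ (e.orthonormal.1 _), ← Finset.smul_sum,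
      Finset.sum_sub_distrib, ← Finset.mul_sum, sum_inner_smul_cl, cl_mul_self,
      Finset.sum_const, Finset.card_univ, Fintype.card_fin]
    module
  have := Module.Finite.of_basis e.toBasis.ExteriorAlgebra
  simp only [← Module.End.mul_eq_comp]
  rw [← map_sum, hsum, map_smul, LinearMap.trace_one, finrank_exteriorAlgebra e, smul_eq_mul]
  push_cast
  ring
end
end

section
/- Let (e_1,…,e_n) be an orthonormal basis of V and X, Y, Z ∈ V. Then Σ_{j=1}^n tr(c(X)∘c(Y)∘c(Z)∘c(e_j)∘c(X)∘c(Y)∘c(Z)∘c(e_j)) = 2^n·[(n−6)·‖X‖²‖Y‖²‖Z‖² + (8−2n)·(‖X‖²⟨Y,Z⟩² + ‖Y‖²⟨X,Z⟩² + ‖Z‖²⟨X,Y⟩²) + (4n−16)·⟨X,Y⟩⟨X,Z⟩⟨Y,Z⟩]. -/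
open scoped RealInnerProductSpace

noncomputable section

variable {V : Type*} [NormedAddCommGroup V] [InnerProductSpace ℝ V]

section CliffordMap

variable {A : Type*} [Ring A] [Algebra ℝ A] {c : V →ₗ[ℝ] A}

lemma clifford_mul_swap (hc : ∀ v, c v * c v = -(‖v‖ ^ 2 • (1 : A))) (v w : V) :
    c v * c w = -(c w * c v) - (2 * ⟪v, w⟫) • (1 : A) := by
  have h := hc (v + w)
  simp only [map_add, add_mul, mul_add, hc, norm_add_sq_real, add_smul, neg_add] at h
  rw [eq_sub_iff_add_eq, ← sub_eq_zero]
  rw [← sub_eq_zero] at h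
  rw [← h]
  abel

lemma clifford_mul_mul_swap (hc : ∀ v, c v * c v = -(‖v‖ ^ 2 • (1 : A))) (v w : V) (a : A) :
    c v * (c w * a) = -(c w * (c v * a)) - (2 * ⟪v, w⟫) • a := by
  rw [← mul_assoc, clifford_mul_swap hc, sub_mul, neg_mul, mul_assoc, smul_mul_assoc, one_mul]

lemma sum_clifford_mul_self (hc : ∀ v, c v * c v = -(‖v‖ ^ 2 • (1 : A))) {n : ℕ}
    (e : OrthonormalBasis (Fin n) ℝ V) :
    ∑ j, c (e j) * c (e j) = -((n : ℝ) • (1 : A)) := by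
  simp [hc, Nat.cast_smul_eq_nsmul]

lemma sum_clifford_mul_mul_clifford (hc : ∀ v, c v * c v = -(‖v‖ ^ 2 • (1 : A))) {n : ℕ}
    (e : OrthonormalBasis (Fin n) ℝ V) (v : V) (a : A) :
    ∑ j, c (e j) * (a * c v) * c (e j)
      = -((∑ j, c (e j) * a * c (e j)) * c v) - (2 : ℝ) • (c v * a) := by
  have hj : ∀ j, c (e j) * (a * c v) * c (e j)
      = -(c (e j) * a * c (e j) * c v) - (2 : ℝ) • (c (⟪e j, v⟫ • e j) * a) := fun j => by
    rw [mul_assoc, mul_assoc, clifford_mul_swap hc v (e j), mul_sub, mul_sub, real_inner_comm]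
    simp only [mul_smul_comm, smul_mul_assoc, mul_one, mul_neg, mul_assoc, mul_smul, map_smul]
  rw [Finset.sum_congr rfl fun j _ => hj j, Finset.sum_sub_distrib, Finset.sum_neg_distrib,
    ← Finset.sum_mul, ← Finset.smul_sum, ← Finset.sum_mul, ← map_sum, e.sum_repr']

lemma sum_clifford_mul_three_mul_clifford (hc : ∀ v, c v * c v = -(‖v‖ ^ 2 • (1 : A))) {n : ℕ}
    (e : OrthonormalBasis (Fin n) ℝ V) (X Y Z : V) :
    ∑ j, c (e j) * (c X * c Y * c Z) * c (e j)
      = ((n : ℝ) - 2) • (c X * c Y * c Z) + (2 : ℝ) • (c Y * c X * c Z)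
        - (2 : ℝ) • (c Z * (c X * c Y)) := by
  have h := sum_clifford_mul_mul_clifford hc e X 1
  simp only [one_mul, mul_one, sum_clifford_mul_self hc] at h
  rw [sum_clifford_mul_mul_clifford hc, sum_clifford_mul_mul_clifford hc, h]
  simp only [neg_mul, sub_mul, smul_mul_assoc, one_mul]
  module

variable {τ : A →ₗ[ℝ] ℝ}

lemma trace_clifford_two (hc : ∀ v, c v * c v = -(‖v‖ ^ 2 • (1 : A)))
    (hτ : ∀ a b, τ (a * b) = τ (b * a)) (u v : V) :
    τ (c u * c v) = -(τ 1 * ⟪u, v⟫) := by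
  have h := congrArg τ (clifford_mul_swap hc u v)
  simp only [map_sub, map_neg, map_smul, smul_eq_mul, hτ (c v) (c u)] at h
  linarith

lemma trace_clifford_four (hc : ∀ v, c v * c v = -(‖v‖ ^ 2 • (1 : A)))
    (hτ : ∀ a b, τ (a * b) = τ (b * a)) (u v w x : V) :
    τ (c u * (c v * (c w * c x)))
      = τ 1 * (⟪u, v⟫ * ⟪w, x⟫ - ⟪u, w⟫ * ⟪v, x⟫ + ⟪u, x⟫ * ⟪v, w⟫) := by
  have h' := hτ (c u) (c v * (c w * c x))
  have h := congrArg τ (clifford_mul_mul_swap hc u v (c w * c x))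
  rw [clifford_mul_mul_swap hc u w, clifford_mul_swap hc u x] at h
  simp only [mul_sub, mul_neg, mul_smul_comm, mul_one, map_sub, map_neg, map_smul, smul_eq_mul,
    trace_clifford_two hc hτ] at h
  simp only [mul_assoc] at h'
  linarith

lemma trace_clifford_six (hc : ∀ v, c v * c v = -(‖v‖ ^ 2 • (1 : A)))
    (hτ : ∀ a b, τ (a * b) = τ (b * a)) (u v w x y z : V) :
    τ (c u * (c v * (c w * (c x * (c y * c z)))))
      = -(⟪u, v⟫ * τ (c w * (c x * (c y * c z))))
        + ⟪u, w⟫ * τ (c v * (c x * (c y * c z)))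
        - ⟪u, x⟫ * τ (c v * (c w * (c y * c z)))
        + ⟪u, y⟫ * τ (c v * (c w * (c x * c z)))
        - ⟪u, z⟫ * τ (c v * (c w * (c x * c y))) := by
  have h' := hτ (c u) (c v * (c w * (c x * (c y * c z))))
  have h := congrArg τ (clifford_mul_mul_swap hc u v (c w * (c x * (c y * c z))))
  rw [clifford_mul_mul_swap hc u w, clifford_mul_mul_swap hc u x, clifford_mul_mul_swap hc u y,
    clifford_mul_swap hc u z] at h
  simp only [mul_sub, mul_neg, mul_smul_comm, mul_one, map_sub, map_neg, map_smul,
    smul_eq_mul] at h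
  simp only [mul_assoc] at h'
  linarith

lemma sum_trace_clifford_eight (hc : ∀ v, c v * c v = -(‖v‖ ^ 2 • (1 : A)))
    (hτ : ∀ a b, τ (a * b) = τ (b * a)) {n : ℕ} (e : OrthonormalBasis (Fin n) ℝ V) (X Y Z : V) :
    ∑ j, τ (c X * c Y * c Z * (c (e j) * (c X * c Y * c Z) * c (e j)))
      = τ 1 *
          (((n : ℝ) - 6) * ‖X‖ ^ 2 * ‖Y‖ ^ 2 * ‖Z‖ ^ 2 +
            (8 - 2 * (n : ℝ)) *
              (‖X‖ ^ 2 * ⟪Y, Z⟫ ^ 2 + ‖Y‖ ^ 2 * ⟪X, Z⟫ ^ 2 + ‖Z‖ ^ 2 * ⟪X, Y⟫ ^ 2) +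
            (4 * (n : ℝ) - 16) * (⟪X, Y⟫ * ⟪X, Z⟫ * ⟪Y, Z⟫)) := by
  rw [← map_sum, ← Finset.mul_sum, sum_clifford_mul_three_mul_clifford hc]
  simp only [mul_sub, mul_add, mul_smul_comm, mul_assoc, map_sub, map_add, map_smul, smul_eq_mul,
    trace_clifford_six hc hτ, trace_clifford_four hc hτ, real_inner_self_eq_norm_sq,
    real_inner_comm X Y, real_inner_comm X Z, real_inner_comm Y Z]
  ring

end CliffordMap

lemma cl_add (v w : V) : cl (v + w) = cl v + cl w := by
  refine LinearMap.ext fun x => ?_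
  change ExteriorAlgebra.ι ℝ (v + w) * x - CliffordAlgebra.contractLeft (innerₛₗ ℝ (v + w)) x
    = (ExteriorAlgebra.ι ℝ v * x - CliffordAlgebra.contractLeft (innerₛₗ ℝ v) x)
      + (ExteriorAlgebra.ι ℝ w * x - CliffordAlgebra.contractLeft (innerₛₗ ℝ w) x)
  rw [map_add, map_add, map_add, LinearMap.add_apply, add_mul]
  abel

lemma cl_smul (r : ℝ) (v : V) : cl (r • v) = r • cl v := by
  refine LinearMap.ext fun x => ?_
  change ExteriorAlgebra.ι ℝ (r • v) * x - CliffordAlgebra.contractLeft (innerₛₗ ℝ (r • v)) x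
    = r • (ExteriorAlgebra.ι ℝ v * x - CliffordAlgebra.contractLeft (innerₛₗ ℝ v) x)
  have h : innerₛₗ ℝ (r • v) = r • innerₛₗ ℝ v := by ext; simp
  rw [h, map_smul, map_smul, LinearMap.smul_apply, smul_mul_assoc, smul_sub]

/-- The Clifford action `c` as a linear map. -/
def clLin : V →ₗ[ℝ] Module.End ℝ (ExteriorAlgebra ℝ V) where
  toFun := cl
  map_add' := cl_add
  map_smul' := cl_smul

lemma clLin_apply (v : V) : clLin v = cl v := rfl

lemma clLin_mul_self (v : V) :
    clLin v * clLin v = -(‖v‖ ^ 2 • (1 : Module.End ℝ (ExteriorAlgebra ℝ V))) := by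
  refine LinearMap.ext fun x => ?_
  let d : ExteriorAlgebra ℝ V →ₗ[ℝ] ExteriorAlgebra ℝ V :=
    CliffordAlgebra.contractLeft (Q := (0 : QuadraticForm ℝ V)) (innerₛₗ ℝ v)
  have h₁ : d (ExteriorAlgebra.ι ℝ v * x) = ⟪v, v⟫ • x - ExteriorAlgebra.ι ℝ v * d x :=
    CliffordAlgebra.contractLeft_ι_mul (Q := (0 : QuadraticForm ℝ V)) (innerₛₗ ℝ v) v x
  have h₂ : d (d x) = 0 :=
    CliffordAlgebra.contractLeft_contractLeft (Q := (0 : QuadraticForm ℝ V)) (innerₛₗ ℝ v) x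
  change ExteriorAlgebra.ι ℝ v * (ExteriorAlgebra.ι ℝ v * x - d x)
    - d (ExteriorAlgebra.ι ℝ v * x - d x) = -(‖v‖ ^ 2 • x)
  rw [map_sub, h₁, h₂, real_inner_self_eq_norm_sq, mul_sub, ← mul_assoc,
    ExteriorAlgebra.ι_sq_zero, zero_mul]
  abel

/-- The exterior algebra of an `n`-dimensional space has dimension `2 ^ n`. -/
lemma trΛ_one {n : ℕ} (e : OrthonormalBasis (Fin n) ℝ V) :
    trΛ (1 : Module.End ℝ (ExteriorAlgebra ℝ V)) = 2 ^ n := by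
  have b := e.toBasis.ExteriorAlgebra
  have := Module.Free.of_basis b
  have := Module.Finite.of_basis b
  rw [LinearMap.trace_one, Module.finrank_eq_card_basis b]
  simp

theorem trace_sum_ccc_XYZj [FiniteDimensional ℝ V] (n : ℕ)
    (e : OrthonormalBasis (Fin n) ℝ V) (X Y Z : V) :
    ∑ j : Fin n,
        trΛ (cl X ∘ₗ cl Y ∘ₗ cl Z ∘ₗ cl (e j) ∘ₗ
              cl X ∘ₗ cl Y ∘ₗ cl Z ∘ₗ cl (e j))
      = (2 : ℝ) ^ n *
          (((n : ℝ) - 6) * ‖X‖ ^ 2 * ‖Y‖ ^ 2 * ‖Z‖ ^ 2 +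
            (8 - 2 * (n : ℝ)) *
              (‖X‖ ^ 2 * ⟪Y, Z⟫ ^ 2 + ‖Y‖ ^ 2 * ⟪X, Z⟫ ^ 2 + ‖Z‖ ^ 2 * ⟪X, Y⟫ ^ 2) +
            (4 * (n : ℝ) - 16) * (⟪X, Y⟫ * ⟪X, Z⟫ * ⟪Y, Z⟫)) := by
  have hcomp : ∀ f g h k : Module.End ℝ (ExteriorAlgebra ℝ V),
      f ∘ₗ g ∘ₗ h ∘ₗ k ∘ₗ f ∘ₗ g ∘ₗ h ∘ₗ k = f * g * h * (k * (f * g * h) * k) :=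
    fun _ _ _ _ => rfl
  have key := sum_trace_clifford_eight (τ := trΛ) clLin_mul_self
    (LinearMap.trace_mul_comm ℝ) e X Y Z
  rw [trΛ_one e] at key
  simp only [hcomp, ← clLin_apply]
  exact key
end
end
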